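/- Let λ < 0, and for n ≥ 2 let b_n be the unique real number with F_λ(b_n) = 1 - 1/n. Define h_n(x) = n log F_λ(b_n + x/((1+λ²) b_n)) + e^{-x}, κ(x) = 2^{-1}(1+λ²)^{-1}(x² + 4x) e^{-x}, and ω(x) = -8^{-1} λ^{-2} (1+λ²)^{-2} (λ² x⁴ + 8λ² x³ + 24λ² x² + 16(1+3λ²) x) e^{-x}. Then for every real x, b_n² ( b_n² h_n(x) - κ(x) ) → ω(x) as n → ∞. -/

import Mathlib

open Real MeasureTheory Filter Topology

/-- Standard normal density. -/
noncomputable def stdPhi (x : ℝ) : ℝ := (Real.sqrt (2 * Real.pi))⁻¹ * Real.exp (-(x ^ 2) / 2)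

/-- Standard normal cdf. -/
noncomputable def stdCdf (x : ℝ) : ℝ := ∫ t in Set.Iic x, stdPhi t

/-- Skew normal density with shape parameter l. -/
noncomputable def snPdf (l x : ℝ) : ℝ := 2 * stdPhi x * stdCdf (l * x)

/-- Skew normal cdf with shape parameter l. -/
noncomputable def snCdf (l x : ℝ) : ℝ := ∫ t in Set.Iic x, snPdf l t

/-- Gumbel extreme value distribution function. -/
noncomputable def gumbel (x : ℝ) : ℝ := Real.exp (-Real.exp (-x))

/-- $\kappa(x)$ for $\lambda<0$. -/
noncomputable def kappaNeg (l x : ℝ) : ℝ :=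
  2⁻¹ * (1 + l ^ 2)⁻¹ * (x ^ 2 + 4 * x) * Real.exp (-x)

/-- $\omega(x)$ for $\lambda<0$. -/
noncomputable def omegaNeg (l x : ℝ) : ℝ :=
  -(8⁻¹ * (l ^ 2)⁻¹ * ((1 + l ^ 2) ^ 2)⁻¹ *
    (l ^ 2 * x ^ 4 + 8 * l ^ 2 * x ^ 3 + 24 * l ^ 2 * x ^ 2 +
      16 * (1 + 3 * l ^ 2) * x) * Real.exp (-x))

section aux

lemma aux_phi_eq : stdPhi = ProbabilityTheory.gaussianPDFReal 0 1 := by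
  funext x; simp [stdPhi, ProbabilityTheory.gaussianPDFReal]

lemma aux_phi_int : Integrable stdPhi := by
  rw [aux_phi_eq]; exact ProbabilityTheory.integrable_gaussianPDFReal 0 1

lemma aux_phi_one : ∫ t, stdPhi t = 1 := by
  rw [aux_phi_eq]; exact ProbabilityTheory.integral_gaussianPDFReal_eq_one 0 one_ne_zero

lemma aux_phi_cont : Continuous stdPhi := by unfold stdPhi; fun_prop

lemma aux_phi_pos (x : ℝ) : 0 < stdPhi x := by unfold stdPhi; positivity

lemma aux_phi_even (x : ℝ) : stdPhi (-x) = stdPhi x := by simp [stdPhi]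

lemma aux_phi_deriv (x : ℝ) : HasDerivAt stdPhi (-x * stdPhi x) x := by
  unfold stdPhi
  have h : HasDerivAt (fun x : ℝ => -(x ^ 2) / 2) (-x) x := by
    have := ((hasDerivAt_pow 2 x).neg).div_const 2
    refine this.congr_deriv ?_
    norm_num
    ring
  refine ((h.exp).const_mul ((Real.sqrt (2 * Real.pi))⁻¹)).congr_deriv ?_
  ring

lemma aux_Iic_deriv (f : ℝ → ℝ) (hf : Integrable f) (hc : Continuous f) (t : ℝ) :
    HasDerivAt (fun t => ∫ s in Set.Iic t, f s) (f t) t := by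
  have h1 : (fun t => ∫ s in Set.Iic t, f s) =
      fun t => (∫ s in Set.Iic (0:ℝ), f s) + ∫ s in (0:ℝ)..t, f s := by
    funext t
    rw [← intervalIntegral.integral_Iic_sub_Iic hf.integrableOn hf.integrableOn]; ring
  rw [h1]
  exact (intervalIntegral.integral_hasDerivAt_right hf.intervalIntegrable
    (hc.stronglyMeasurableAtFilter _ _) hc.continuousAt).const_add _

lemma aux_Iic_tendsto (f : ℝ → ℝ) (hf : Integrable f) :
    Tendsto (fun t => ∫ s in Set.Iic t, f s) atTop (𝓝 (∫ s, f s)) :=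
  (aecover_Iic tendsto_id).integral_tendsto_of_countably_generated hf

lemma aux_cdf_deriv (t : ℝ) : HasDerivAt stdCdf (stdPhi t) t :=
  aux_Iic_deriv stdPhi aux_phi_int aux_phi_cont t

lemma aux_cdf_cont : Continuous stdCdf :=
  continuous_iff_continuousAt.2 fun t => (aux_cdf_deriv t).continuousAt

lemma aux_cdf_neg (t : ℝ) : stdCdf (-t) = 1 - stdCdf t := by
  have h1 : stdCdf (-t) = ∫ s in Set.Ioi t, stdPhi s := by
    unfold stdCdf
    rw [← integral_comp_neg_Ioi t stdPhi]
    simp only [aux_phi_even]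
  rw [h1, ← aux_phi_one, ← intervalIntegral.integral_Iic_add_Ioi (b := t) aux_phi_int.integrableOn aux_phi_int.integrableOn]
  simp [stdCdf]

lemma aux_cdf_pos (t : ℝ) : 0 < stdCdf t := by
  unfold stdCdf
  rw [setIntegral_pos_iff_support_of_nonneg_ae
    (Eventually.of_forall fun x => (aux_phi_pos x).le) aux_phi_int.integrableOn]
  have : Function.support stdPhi = Set.univ := by
    ext x; simp [(aux_phi_pos x).ne']
  simp [this]

lemma aux_cdf_lt_one (t : ℝ) : stdCdf t < 1 := by
  have := aux_cdf_pos (-t); rw [aux_cdf_neg] at this; linarith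

lemma aux_pdf_pos (l x : ℝ) : 0 < snPdf l x := by
  unfold snPdf; have := aux_phi_pos x; have := aux_cdf_pos (l * x); positivity

lemma aux_pdf_cont (l : ℝ) : Continuous (snPdf l) := by
  unfold snPdf
  exact (continuous_const.mul aux_phi_cont).mul (aux_cdf_cont.comp (by fun_prop))

lemma aux_pdf_int (l : ℝ) : Integrable (snPdf l) := by
  refine (aux_phi_int.const_mul 2).mono' (aux_pdf_cont l).aestronglyMeasurable ?_
  refine Eventually.of_forall fun x => ?_
  rw [Real.norm_of_nonneg (aux_pdf_pos l x).le]
  unfold snPdf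
  have := aux_phi_pos x
  have := (aux_cdf_lt_one (l * x)).le
  nlinarith

lemma aux_pdf_one (l : ℝ) : ∫ t, snPdf l t = 1 := by
  have h1 : ∫ t, snPdf l (-t) = ∫ t, snPdf l t := integral_neg_eq_self _ _
  have h2 : ∫ t, (snPdf l t + snPdf l (-t)) = ∫ t, 2 * stdPhi t := by
    congr 1; funext t
    unfold snPdf
    rw [aux_phi_even, mul_neg, aux_cdf_neg]; ring
  rw [integral_add (aux_pdf_int l) (aux_pdf_int l).comp_neg, h1, integral_const_mul,
    aux_phi_one] at h2
  linarith

noncomputable def auxG (l t : ℝ) : ℝ := 1 - snCdf l t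

lemma auxG_deriv (l t : ℝ) : HasDerivAt (auxG l) (-snPdf l t) t :=
  (aux_Iic_deriv _ (aux_pdf_int l) (aux_pdf_cont l) t).const_sub 1

lemma auxG_tendsto (l : ℝ) : Tendsto (auxG l) atTop (𝓝 0) := by
  have := (aux_Iic_tendsto _ (aux_pdf_int l)).const_sub 1
  rw [aux_pdf_one, sub_self] at this
  exact this

lemma auxG_anti (l : ℝ) : StrictAnti (auxG l) := by
  apply strictAnti_of_deriv_neg
  intro x
  rw [(auxG_deriv l x).deriv]
  linarith [aux_pdf_pos l x]

lemma auxG_pos (l t : ℝ) : 0 < auxG l t := by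
  have h : 0 ≤ auxG l (t + 1) := (auxG_anti l).antitone.le_of_tendsto (auxG_tendsto l) _
  exact h.trans_lt (auxG_anti l (by linarith))

lemma aux_phi_tendsto : Tendsto stdPhi atTop (𝓝 0) := by
  have h : Tendsto (fun x : ℝ => -(x ^ 2) / 2) atTop atBot := by
    have : Tendsto (fun x : ℝ => x ^ 2 / 2) atTop atTop :=
      (tendsto_pow_atTop two_ne_zero).atTop_div_const two_pos
    convert tendsto_neg_atTop_atBot.comp this using 1
    funext x; simp; ring
  have := (Real.tendsto_exp_atBot.comp h).const_mul ((Real.sqrt (2 * Real.pi))⁻¹)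
  rw [mul_zero] at this
  exact this

/-- Mills ratio expansion. -/
lemma aux_mills : Tendsto (fun s : ℝ => (stdCdf (-s) - stdPhi s * (s⁻¹ - (s⁻¹) ^ 3 + 3 * (s⁻¹) ^ 5)) /
    (stdPhi s * (s⁻¹) ^ 5)) atTop (𝓝 0) := by
  have hi : Tendsto (fun s : ℝ => s⁻¹) atTop (𝓝 0) := tendsto_inv_atTop_zero
  refine HasDerivAt.lhopital_zero_atTop (f' := fun s => 15 * (s⁻¹) ^ 6 * stdPhi s)
    (g' := fun s => -(stdPhi s * ((s⁻¹) ^ 4 + 5 * (s⁻¹) ^ 6))) ?_ ?_ ?_ ?_ ?_ ?_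
  · filter_upwards [eventually_gt_atTop 0] with s hs
    have hinv := hasDerivAt_inv hs.ne'
    have h1 : HasDerivAt (fun s => stdCdf (-s)) (-stdPhi s) s := by
      have := (aux_cdf_deriv (-s)).comp s (hasDerivAt_neg s)
      rw [aux_phi_even] at this
      simpa [Function.comp_def] using this
    have := h1.sub ((aux_phi_deriv s).mul ((hinv.sub (hinv.pow 3)).add ((hinv.pow 5).const_mul 3)))
    refine this.congr_deriv ?_
    norm_num [Pi.sub_apply, Pi.add_apply, Pi.pow_apply]
    field_simp
    ring
  · filter_upwards [eventually_gt_atTop 0] with s hs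
    have hinv := hasDerivAt_inv hs.ne'
    have := (aux_phi_deriv s).mul (hinv.pow 5)
    refine this.congr_deriv ?_
    norm_num [Pi.pow_apply]
    field_simp
    ring
  · filter_upwards [eventually_gt_atTop 0] with s hs
    have := aux_phi_pos s
    have : 0 < stdPhi s * ((s⁻¹) ^ 4 + 5 * (s⁻¹) ^ 6) := by positivity
    linarith
  · have h1 : Tendsto (fun s => stdCdf (-s)) atTop (𝓝 0) := by
      have := (aux_Iic_tendsto _ aux_phi_int).const_sub 1
      rw [aux_phi_one, sub_self] at this
      refine this.congr fun s => ?_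
      rw [aux_cdf_neg]; rfl
    have := h1.sub (aux_phi_tendsto.mul ((hi.sub (hi.pow 3)).add ((hi.pow 5).const_mul 3)))
    simpa using this
  · simpa using aux_phi_tendsto.mul (hi.pow 5)
  · have h : Tendsto (fun s : ℝ => -(15 * (s⁻¹) ^ 2 / (1 + 5 * (s⁻¹) ^ 2))) atTop (𝓝 0) := by
      have := (((hi.pow 2).const_mul 15).div (((hi.pow 2).const_mul 5).const_add 1) (by norm_num)).neg
      simpa using this
    refine h.congr' ?_
    filter_upwards [eventually_gt_atTop 0] with s hs
    have := aux_phi_pos s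
    field_simp

noncomputable def auxE (m t : ℝ) : ℝ := Real.exp (-(m * t ^ 2 / 2))

lemma auxE_pos (m t : ℝ) : 0 < auxE m t := Real.exp_pos _

lemma auxE_deriv (m t : ℝ) : HasDerivAt (auxE m) (-(m * t) * auxE m t) t := by
  unfold auxE
  have h : HasDerivAt (fun t : ℝ => -(m * t ^ 2 / 2)) (-(m * t)) t := by
    refine ((((hasDerivAt_pow 2 t).const_mul m).div_const 2).neg).congr_deriv ?_
    norm_num
    ring
  exact h.exp.congr_deriv (by ring)

lemma auxE_tendsto (m : ℝ) (hm : 0 < m) : Tendsto (auxE m) atTop (𝓝 0) := by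
  have : Tendsto (fun t : ℝ => m * t ^ 2 / 2) atTop atTop :=
    ((tendsto_pow_atTop two_ne_zero).const_mul_atTop hm).atTop_div_const two_pos
  exact Real.tendsto_exp_neg_atTop_nhds_zero.comp this

lemma aux_phi_mul (a t : ℝ) : stdPhi t * stdPhi (a * t) = (2 * Real.pi)⁻¹ * auxE (1 + a ^ 2) t := by
  have hpi := Real.pi_pos
  have h : (Real.sqrt (2 * Real.pi))⁻¹ * (Real.sqrt (2 * Real.pi))⁻¹ = (2 * Real.pi)⁻¹ := by
    rw [← mul_inv, Real.mul_self_sqrt (by positivity)]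
  unfold stdPhi auxE
  rw [mul_mul_mul_comm, h, ← Real.exp_add]
  congr 2
  ring

noncomputable def auxEps (s : ℝ) : ℝ :=
  (stdCdf (-s) - stdPhi s * (s⁻¹ - (s⁻¹) ^ 3 + 3 * (s⁻¹) ^ 5)) / (stdPhi s * (s⁻¹) ^ 5)

lemma aux_pdf_expand (a t : ℝ) (ha : 0 < a) (ht : 0 < t) : snPdf (-a) t =
    Real.pi⁻¹ * auxE (1 + a ^ 2) t * ((a * t)⁻¹ - ((a * t)⁻¹) ^ 3 +
      (3 + auxEps (a * t)) * ((a * t)⁻¹) ^ 5) := by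
  have hs : 0 < a * t := by positivity
  have h : stdCdf (-(a * t)) = stdPhi (a * t) * ((a * t)⁻¹ - ((a * t)⁻¹) ^ 3 +
      (3 + auxEps (a * t)) * ((a * t)⁻¹) ^ 5) := by
    unfold auxEps
    have := aux_phi_pos (a * t)
    field_simp
    ring
  unfold snPdf
  rw [neg_mul, h]
  have h2 := aux_phi_mul a t
  have : Real.pi⁻¹ * auxE (1 + a ^ 2) t = 2 * (stdPhi t * stdPhi (a * t)) := by
    rw [h2]; rw [mul_inv]; ring
  rw [this]; ring

noncomputable def auxC1 (a : ℝ) : ℝ := -2 / (1 + a ^ 2) - 1 / a ^ 2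
noncomputable def auxC2 (a : ℝ) : ℝ := (3 * (1 + a ^ 2) / a ^ 4 - 4 * auxC1 a) / (1 + a ^ 2)
noncomputable def auxC (a : ℝ) : ℝ := (Real.pi * a * (1 + a ^ 2))⁻¹

noncomputable def auxD (a t : ℝ) : ℝ :=
  (auxG (-a) t - auxC a * auxE (1 + a ^ 2) t *
    ((t⁻¹) ^ 2 + auxC1 a * (t⁻¹) ^ 4 + auxC2 a * (t⁻¹) ^ 6)) /
    (auxC a * auxE (1 + a ^ 2) t * (t⁻¹) ^ 6)

lemma auxD_tendsto (a : ℝ) (ha : 0 < a) : Tendsto (auxD a) atTop (𝓝 0) := by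
  have hi : Tendsto (fun s : ℝ => s⁻¹) atTop (𝓝 0) := tendsto_inv_atTop_zero
  have hm : 0 < 1 + a ^ 2 := by positivity
  have hC : 0 < auxC a := by have := Real.pi_pos; unfold auxC; positivity
  set m := 1 + a ^ 2 with hmdef
  have hEt := (auxE_tendsto m hm).const_mul (auxC a)
  refine HasDerivAt.lhopital_zero_atTop
    (f' := fun t => -snPdf (-a) t + auxC a * auxE m t * (m * t⁻¹ + (2 + auxC1 a * m) * (t⁻¹) ^ 3
      + (4 * auxC1 a + m * auxC2 a) * (t⁻¹) ^ 5 + 6 * auxC2 a * (t⁻¹) ^ 7))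
    (g' := fun t => -(auxC a * auxE m t * (m * (t⁻¹) ^ 5 + 6 * (t⁻¹) ^ 7))) ?_ ?_ ?_ ?_ ?_ ?_
  · filter_upwards [eventually_gt_atTop 0] with s hs
    have hinv := hasDerivAt_inv hs.ne'
    have := (auxG_deriv (-a) s).sub (((auxE_deriv m s).const_mul (auxC a)).mul
      (((hinv.pow 2).add ((hinv.pow 4).const_mul (auxC1 a))).add ((hinv.pow 6).const_mul (auxC2 a))))
    refine this.congr_deriv ?_
    norm_num [Pi.add_apply, Pi.pow_apply]
    field_simp
    ring
  · filter_upwards [eventually_gt_atTop 0] with s hs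
    have hinv := hasDerivAt_inv hs.ne'
    have := ((auxE_deriv m s).const_mul (auxC a)).mul (hinv.pow 6)
    refine this.congr_deriv ?_
    norm_num [Pi.pow_apply]
    field_simp
    ring
  · filter_upwards [eventually_gt_atTop 0] with s hs
    have := auxE_pos m s
    have : 0 < (auxC a * auxE m s * (m * (s⁻¹) ^ 5 + 6 * (s⁻¹) ^ 7)) := by positivity
    linarith
  · have := (auxG_tendsto (-a)).sub (hEt.mul (((hi.pow 2).add ((hi.pow 4).const_mul (auxC1 a))).add
      ((hi.pow 6).const_mul (auxC2 a))))
    simpa using this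
  · simpa using hEt.mul (hi.pow 6)
  · have hε : Tendsto (fun t => auxEps (a * t)) atTop (𝓝 0) :=
      aux_mills.comp (tendsto_id.const_mul_atTop ha)
    have h : Tendsto (fun s : ℝ => (auxEps (a * s) * (m / a ^ 4) - 6 * auxC2 a * (s⁻¹) ^ 2) /
        (m + 6 * (s⁻¹) ^ 2)) atTop (𝓝 0) := by
      have := ((hε.mul_const (m / a ^ 4)).sub ((hi.pow 2).const_mul (6 * auxC2 a))).div
        (((hi.pow 2).const_mul 6).const_add m) (by simpa using hm.ne')
      simpa [Pi.div_def] using this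
    refine h.congr' ?_
    filter_upwards [eventually_gt_atTop 0] with s hs
    have hE := auxE_pos m s
    rw [aux_pdf_expand a s ha hs, ← hmdef]
    have e1 : 2 + auxC1 a * m = -m / a ^ 2 := by
      unfold auxC1; rw [← hmdef]; field_simp; ring
    have e2 : 4 * auxC1 a + m * auxC2 a = 3 * m / a ^ 4 := by
      unfold auxC2; rw [← hmdef]; field_simp; ring
    rw [e1, e2]
    generalize auxC2 a = c2
    generalize auxEps (a * s) = ε
    have hpi := Real.pi_pos
    have e3 : Real.pi⁻¹ = auxC a * (a * m) := by
      unfold auxC; rw [← hmdef]; field_simp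
    rw [e3]
    field_simp
    ring

lemma auxG_expand (a t : ℝ) (ha : 0 < a) (ht : 0 < t) : auxG (-a) t =
    auxC a * auxE (1 + a ^ 2) t * (t⁻¹) ^ 2 *
      (1 + auxC1 a * (t⁻¹) ^ 2 + (auxC2 a + auxD a t) * (t⁻¹) ^ 4) := by
  have hpi := Real.pi_pos
  have hC : 0 < auxC a := by unfold auxC; positivity
  have := auxE_pos (1 + a ^ 2) t
  unfold auxD
  field_simp
  ring

lemma aux_first {v A : ℝ → ℝ} {α β : ℝ} (hv : Tendsto v atTop atTop)
    (hA : Tendsto (fun y => v y * (v y * (A y - 1) - α)) atTop (𝓝 β)) :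
    Tendsto (fun y => v y * (A y - 1)) atTop (𝓝 α) := by
  have h := ((tendsto_inv_atTop_zero.comp hv).mul hA).add_const α
  rw [zero_mul, zero_add] at h
  refine h.congr' ?_
  filter_upwards [hv.eventually_gt_atTop 0] with y hy
  simp only [Function.comp]
  field_simp
  ring

lemma aux_one {v A : ℝ → ℝ} {α β : ℝ} (hv : Tendsto v atTop atTop)
    (hA : Tendsto (fun y => v y * (v y * (A y - 1) - α)) atTop (𝓝 β)) :
    Tendsto A atTop (𝓝 1) := by
  have h := ((tendsto_inv_atTop_zero.comp hv).mul (aux_first hv hA)).add_const 1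
  rw [zero_mul, zero_add] at h
  refine h.congr' ?_
  filter_upwards [hv.eventually_gt_atTop 0] with y hy
  simp only [Function.comp]
  field_simp
  ring

lemma aux_mulexp {v A B : ℝ → ℝ} {α β α' β' : ℝ} (hv : Tendsto v atTop atTop)
    (hA : Tendsto (fun y => v y * (v y * (A y - 1) - α)) atTop (𝓝 β))
    (hB : Tendsto (fun y => v y * (v y * (B y - 1) - α')) atTop (𝓝 β')) :
    Tendsto (fun y => v y * (v y * (A y * B y - 1) - (α + α'))) atTop (𝓝 (β + β' + α * α')) := by
  refine ((hA.add hB).add ((aux_first hv hA).mul (aux_first hv hB))).congr fun y => ?_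
  ring

lemma aux_exp (c : ℝ) {v : ℝ → ℝ} (hv : Tendsto v atTop atTop) :
    Tendsto (fun y => v y * (v y * (Real.exp (-(c / v y)) - 1) - (-c))) atTop (𝓝 (c ^ 2 / 2)) := by
  have hz : Tendsto (fun y => -(c / v y)) atTop (𝓝 0) := by
    simpa using (hv.const_div_atTop c).neg
  have hO := (Real.exp_sub_sum_range_succ_isLittleO_pow 2).comp_tendsto hz
  have h1 : Tendsto (fun y => v y ^ 2 * (Real.exp (-(c / v y)) - ∑ i ∈ Finset.range 3,
      (-(c / v y)) ^ i / (i.factorial : ℝ))) atTop (𝓝 0) := by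
    by_cases hc : c = 0
    · subst hc
      simp [Finset.sum_range_succ]
    have := hO.tendsto_div_nhds_zero.const_mul (c ^ 2)
    rw [mul_zero] at this
    refine this.congr' ?_
    filter_upwards [hv.eventually_gt_atTop 0] with y hy
    simp only [Function.comp]
    generalize (Real.exp (-(c / v y)) - ∑ i ∈ Finset.range (2 + 1),
      (-(c / v y)) ^ i / (i.factorial : ℝ)) = w
    field_simp
  have h2 := h1.add_const (c ^ 2 / 2)
  rw [zero_add] at h2
  refine h2.congr' ?_
  filter_upwards [hv.eventually_gt_atTop 0] with y hy
  simp [Finset.sum_range_succ]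
  generalize Real.exp (-(c / v y)) = w
  field_simp
  ring

lemma aux_r (d : ℝ) {v : ℝ → ℝ} (hv : Tendsto v atTop atTop) :
    Tendsto (fun y => 1 + d / v y) atTop (𝓝 1) := by
  simpa using (hv.const_div_atTop d).const_add 1

lemma aux_inv (d : ℝ) {v : ℝ → ℝ} (hv : Tendsto v atTop atTop) :
    Tendsto (fun y => v y * (v y * (((1 + d / v y) ^ 2)⁻¹ - 1) - (-(2 * d)))) atTop
      (𝓝 (3 * d ^ 2)) := by
  have hr := aux_r d hv
  have h := ((((hv.const_div_atTop d).const_mul 2).const_add 3).const_mul (d ^ 2)).mul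
    ((hr.pow 2).inv₀ (by norm_num))
  have e : d ^ 2 * (3 + 2 * 0) * ((1:ℝ) ^ 2)⁻¹ = 3 * d ^ 2 := by norm_num; ring
  rw [e] at h
  refine h.congr' ?_
  filter_upwards [hv.eventually_gt_atTop 0, hr.eventually_ne one_ne_zero] with y hy hy2
  have : v y + d ≠ 0 := by
    intro h; apply hy2; field_simp; rw [h, mul_zero]
  field_simp
  ring

noncomputable def auxQ (a t : ℝ) : ℝ :=
  1 + auxC1 a * (t⁻¹) ^ 2 + (auxC2 a + auxD a t) * (t⁻¹) ^ 4

lemma auxQ_tendsto (a : ℝ) (ha : 0 < a) : Tendsto (auxQ a) atTop (𝓝 1) := by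
  have hi : Tendsto (fun s : ℝ => s⁻¹) atTop (𝓝 0) := tendsto_inv_atTop_zero
  have := (((hi.pow 2).const_mul (auxC1 a)).const_add 1).add
    (((auxD_tendsto a ha).const_add (auxC2 a)).mul (hi.pow 4))
  have e : (1:ℝ) + auxC1 a * 0 ^ 2 + (auxC2 a + 0) * 0 ^ 4 = 1 := by norm_num
  rw [e] at this
  exact this

lemma aux_sq : Tendsto (fun y : ℝ => y ^ 2) atTop atTop := tendsto_pow_atTop two_ne_zero

lemma aux_t (d : ℝ) : Tendsto (fun y : ℝ => y * (1 + d / y ^ 2)) atTop atTop :=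
  tendsto_id.atTop_mul_pos one_pos (aux_r d aux_sq)

lemma aux_Q (a d : ℝ) (ha : 0 < a) :
    Tendsto (fun y : ℝ => y ^ 2 * (y ^ 2 * (auxQ a (y * (1 + d / y ^ 2)) / auxQ a y - 1) - 0))
      atTop (𝓝 (-(2 * auxC1 a * d))) := by
  have hr := aux_r d aux_sq
  have ht := aux_t d
  have hD := (auxD_tendsto a ha).comp ht
  have hQ := auxQ_tendsto a ha
  have hB := aux_first aux_sq (aux_inv d aux_sq)
  have h4 := (hr.pow 4).inv₀ (by norm_num)
  have h := (((hB.const_mul (auxC1 a)).add ((hD.const_add (auxC2 a)).mul h4)).sub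
    ((auxD_tendsto a ha).const_add (auxC2 a))).div hQ one_ne_zero
  have e : (auxC1 a * -(2 * d) + (auxC2 a + 0) * ((1:ℝ) ^ 4)⁻¹ - (auxC2 a + 0)) / 1 =
    -(2 * auxC1 a * d) := by norm_num; ring
  rw [e] at h
  refine h.congr' ?_
  filter_upwards [eventually_gt_atTop 0, hQ.eventually_ne one_ne_zero,
    hr.eventually_ne one_ne_zero] with y hy hy2 hy3
  simp only [Function.comp, Pi.div_apply]
  generalize hrr : 1 + d / y ^ 2 = r at *
  rw [div_eq_iff hy2]
  have : y ^ 2 * (y ^ 2 * (auxQ a (y * r) / auxQ a y - 1) - 0) * auxQ a y =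
      y ^ 4 * (auxQ a (y * r) - auxQ a y) := by
    field_simp
    ring
  rw [this]
  unfold auxQ
  field_simp
  ring

lemma aux_ratio (a x y : ℝ) (ha : 0 < a) (hy : 0 < y) (ht : 0 < 1 + x / (1 + a ^ 2) / y ^ 2)
    (hq : auxQ a y ≠ 0) :
    auxG (-a) (y * (1 + x / (1 + a ^ 2) / y ^ 2)) / auxG (-a) y =
      Real.exp (-x) * (Real.exp (-(x ^ 2 / (2 * (1 + a ^ 2)) / y ^ 2)) *
        ((1 + x / (1 + a ^ 2) / y ^ 2) ^ 2)⁻¹ *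
        (auxQ a (y * (1 + x / (1 + a ^ 2) / y ^ 2)) / auxQ a y)) := by
  have hm : 0 < 1 + a ^ 2 := by positivity
  have hC : 0 < auxC a := by have := Real.pi_pos; unfold auxC; positivity
  rw [auxG_expand a y ha hy, auxG_expand a _ ha (mul_pos hy ht)]
  have hE : auxE (1 + a ^ 2) (y * (1 + x / (1 + a ^ 2) / y ^ 2)) =
      auxE (1 + a ^ 2) y * (Real.exp (-x) * Real.exp (-(x ^ 2 / (2 * (1 + a ^ 2)) / y ^ 2))) := by
    unfold auxE
    rw [← Real.exp_add, ← Real.exp_add]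
    congr 1
    field_simp
    ring
  rw [hE]
  have hEp := auxE_pos (1 + a ^ 2) y
  change _ * auxQ a _ / (_ * auxQ a y) = _
  generalize auxQ a (y * (1 + x / (1 + a ^ 2) / y ^ 2)) = q1 at *
  generalize (1 + x / (1 + a ^ 2) / y ^ 2) = r at *
  generalize Real.exp (-(x ^ 2 / (2 * (1 + a ^ 2)) / y ^ 2)) = A at *
  generalize auxE (1 + a ^ 2) y = E at *
  field_simp

lemma aux_t4G (a : ℝ) (ha : 0 < a) : Tendsto (fun t => t ^ 4 * auxG (-a) t) atTop (𝓝 0) := by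
  have hm : 0 < 1 + a ^ 2 := by positivity
  have hs : Tendsto (fun t : ℝ => (1 + a ^ 2) * t ^ 2 / 2) atTop atTop :=
    (aux_sq.const_mul_atTop hm).atTop_div_const two_pos
  have h1 := (Real.tendsto_pow_mul_exp_neg_atTop_nhds_zero 1).comp hs
  have h2 := (h1.mul (auxQ_tendsto a ha)).const_mul (auxC a * (2 / (1 + a ^ 2)))
  rw [zero_mul, mul_zero] at h2
  refine h2.congr' ?_
  filter_upwards [eventually_gt_atTop 0] with t ht
  rw [auxG_expand a t ha ht]
  simp only [Function.comp, auxQ, auxE]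
  field_simp

lemma aux_main (a x : ℝ) (ha : 0 < a) :
    Tendsto (fun y : ℝ => y ^ 2 * (y ^ 2 *
      ((auxG (-a) y)⁻¹ * Real.log (snCdf (-a) (y + x / ((1 + a ^ 2) * y))) +
        Real.exp (-x)) - kappaNeg (-a) x)) atTop (𝓝 (omegaNeg (-a) x)) := by
  have hm : 0 < 1 + a ^ 2 := by positivity
  set d := x / (1 + a ^ 2) with hd
  set c := x ^ 2 / (2 * (1 + a ^ 2)) with hc
  have hABQ := aux_mulexp aux_sq (aux_mulexp aux_sq (aux_exp c aux_sq) (aux_inv d aux_sq))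
    (aux_Q a d ha)
  have hR := (aux_one aux_sq hABQ).const_mul (Real.exp (-x))
  have hr := aux_r d aux_sq
  have hQ := auxQ_tendsto a ha
  have hrat : ∀ᶠ y in atTop, auxG (-a) (y * (1 + d / y ^ 2)) / auxG (-a) y =
      Real.exp (-x) * (Real.exp (-(c / y ^ 2)) * ((1 + d / y ^ 2) ^ 2)⁻¹ *
        (auxQ a (y * (1 + d / y ^ 2)) / auxQ a y)) := by
    filter_upwards [eventually_gt_atTop 0, hr.eventually_const_lt one_pos,
      hQ.eventually_ne one_ne_zero] with y h1 h2 h3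
    exact aux_ratio a x y ha h1 h2 h3
  have hR' : Tendsto (fun y => auxG (-a) (y * (1 + d / y ^ 2)) / auxG (-a) y) atTop
      (𝓝 (Real.exp (-x) * 1)) := hR.congr' (hrat.mono fun y h => h.symm)
  have hG4 : Tendsto (fun y => y ^ 4 * auxG (-a) (y * (1 + d / y ^ 2))) atTop (𝓝 0) := by
    have h := ((aux_t4G a ha).comp (aux_t d)).mul ((hr.pow 4).inv₀ (by norm_num))
    rw [zero_mul] at h
    refine h.congr' ?_
    filter_upwards [hr.eventually_ne one_ne_zero] with y h3
    simp only [Function.comp]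
    generalize auxG (-a) (y * (1 + d / y ^ 2)) = g
    generalize 1 + d / y ^ 2 = r at *
    field_simp
  have hlog : Tendsto (fun y => y ^ 4 * ((auxG (-a) y)⁻¹ *
      (Real.log (1 - auxG (-a) (y * (1 + d / y ^ 2))) + auxG (-a) (y * (1 + d / y ^ 2)))))
      atTop (𝓝 0) := by
    have hb := (hG4.mul hR').const_mul 2
    rw [zero_mul, mul_zero] at hb
    refine squeeze_zero_norm' ?_ hb
    have hG0 := (auxG_tendsto (-a)).comp (aux_t d)
    filter_upwards [hG0.eventually_lt_const (show (0:ℝ) < 1/2 by norm_num)] with y hy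
    simp only [Function.comp] at hy
    have hg := auxG_pos (-a) (y * (1 + d / y ^ 2))
    have hg2 := auxG_pos (-a) y
    generalize auxG (-a) (y * (1 + d / y ^ 2)) = g at *
    generalize auxG (-a) y = k at *
    have hl := Real.abs_log_sub_add_sum_range_le (x := g) (by rw [abs_of_pos hg]; linarith) 1
    simp at hl
    rw [abs_of_pos hg] at hl
    have h3 : g ^ 2 / (1 - g) ≤ 2 * g ^ 2 := by
      rw [div_le_iff₀ (by linarith)]
      nlinarith [sq_nonneg g]
    rw [norm_mul, norm_mul, Real.norm_of_nonneg (by positivity : 0 ≤ y ^ 4),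
      Real.norm_of_nonneg (by positivity : 0 ≤ k⁻¹), Real.norm_eq_abs, add_comm (Real.log _)]
    calc y ^ 4 * (k⁻¹ * |g + Real.log (1 - g)|) ≤ y ^ 4 * (k⁻¹ * (2 * g ^ 2)) := by
          gcongr
          exact hl.trans h3
      _ = _ := by field_simp
  have hfin := (hABQ.const_mul (-Real.exp (-x))).add hlog
  have e : -Real.exp (-x) * (c ^ 2 / 2 + 3 * d ^ 2 + -c * -(2 * d) + -(2 * auxC1 a * d) +
      (-c + -(2 * d)) * 0) + 0 = omegaNeg (-a) x := by
    rw [hc, hd]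
    unfold omegaNeg auxC1
    generalize Real.exp (-x) = w
    simp only [neg_sq]
    field_simp
    ring
  rw [e] at hfin
  refine hfin.congr' ?_
  filter_upwards [hrat, eventually_gt_atTop 0] with y hy h0
  have hty : y + x / ((1 + a ^ 2) * y) = y * (1 + d / y ^ 2) := by
    rw [hd]; field_simp
  have hk : kappaNeg (-a) x = -Real.exp (-x) * (-c + -(2 * d) + 0) := by
    rw [hc, hd]
    unfold kappaNeg
    generalize Real.exp (-x) = w
    simp only [neg_sq]
    field_simp
    ring
  have hF : snCdf (-a) (y * (1 + d / y ^ 2)) = 1 - auxG (-a) (y * (1 + d / y ^ 2)) := by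
    unfold auxG; ring
  rw [hty, hk, hF]
  generalize (Real.exp (-(c / y ^ 2)) * ((1 + d / y ^ 2) ^ 2)⁻¹ *
        (auxQ a (y * (1 + d / y ^ 2)) / auxQ a y)) = W at *
  rw [div_eq_mul_inv] at hy
  linear_combination y ^ 4 * hy

end aux

theorem skew_normal_h_second_order_neg (l : ℝ) (hl : l < 0) (b : ℕ → ℝ)
    (hb : ∀ n : ℕ, 2 ≤ n → snCdf l (b n) = 1 - 1 / n) (x : ℝ) :
    Tendsto (fun n : ℕ =>
      (b n) ^ 2 * ((b n) ^ 2 *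
        ((n : ℝ) * Real.log (snCdf l (b n + x / ((1 + l ^ 2) * b n))) +
          Real.exp (-x)) - kappaNeg l x)) atTop (𝓝 (omegaNeg l x)) := by
  obtain ⟨a, rfl⟩ : ∃ a, l = -a := ⟨-l, by ring⟩
  have ha : 0 < a := by linarith
  have hG : ∀ n : ℕ, 2 ≤ n → auxG (-a) (b n) = (n : ℝ)⁻¹ := by
    intro n hn
    unfold auxG
    rw [hb n hn]; simp
  have hbt : Tendsto b atTop atTop := by
    rw [tendsto_atTop]
    intro M
    have h1 := (tendsto_inv_atTop_nhds_zero_nat (𝕜 := ℝ)).eventually_lt_const (auxG_pos (-a) M)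
    filter_upwards [h1, eventually_ge_atTop 2] with n hn h2
    rw [← hG n h2] at hn
    exact ((auxG_anti (-a)).lt_iff_gt.1 hn).le
  refine ((aux_main a x ha).comp hbt).congr' ?_
  filter_upwards [eventually_ge_atTop 2] with n hn
  simp only [Function.comp, hG n hn, inv_inv, neg_sq]
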